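/- Let c, c' ∈ H₁(Γ,ℤ). There exists (T,φ) ∈ OP_Γ with c, c' ∈ σ(T,φ) if and only if (c,e⃗)·(c',e⃗) ≥ 0 for every oriented edge e⃗ ∈ E⃗ (i.e., every edge lying in the supports of both c and c' is oriented in the same direction in c and in c'). -/

import Mathlib

/-!
Serre-style finite graphs: a vertex type `V`, an oriented-edge type `E` with a
fixed-point-free involution `inv` (edge reversal) and source/target maps `s, t`
with `s (inv e) = t e`.  An unoriented edge is an `inv`-orbit `{e, inv e}`;
subsets of unoriented edges are encoded as `inv`-closed subsets of `E`, and an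
orientation of a spanning subgraph `Γ∖T` is encoded by the set `O` of its
positively oriented edges.  1-chains with coefficients in `A` are encoded as
functions `c : E → A` with `c (inv e) = - c e` (so that `(c, e⃗) = c e` for the
standard bilinear form).
-/

structure SerreGraph where
  V : Type
  E : Type
  [fintypeV : Fintype V]
  [fintypeE : Fintype E]
  [decEqV : DecidableEq V]
  [decEqE : DecidableEq E]
  inv : E → E
  s : E → V
  t : E → V
  inv_inv : ∀ e, inv (inv e) = e
  inv_ne : ∀ e, inv e ≠ e
  s_inv : ∀ e, s (inv e) = t e

attribute [instance] SerreGraph.fintypeV SerreGraph.fintypeE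
attribute [instance] SerreGraph.decEqV SerreGraph.decEqE

namespace SerreGraph

variable (Γ : SerreGraph)

/-- Reachability between vertices in the spanning subgraph whose allowed oriented
edges are those in `A`. -/
def Reach (A : Set Γ.E) : Γ.V → Γ.V → Prop :=
  Relation.ReflTransGen (fun a b => ∃ e ∈ A, Γ.s e = a ∧ Γ.t e = b)

/-- The number of connected components of the spanning subgraph with allowed
oriented edges `A`. -/
noncomputable def numComponents (A : Set Γ.E) : ℕ :=
  Nat.card (Quot (fun a b : Γ.V => ∃ e ∈ A, Γ.s e = a ∧ Γ.t e = b))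

/-- The set of separating (oriented) edges: removing the underlying unoriented
edge increases the number of connected components. -/
def Esep : Set Γ.E :=
  {e | Γ.numComponents Set.univ < Γ.numComponents {f | f ≠ e ∧ f ≠ Γ.inv e}}

/-- `T` encodes a set of unoriented edges. -/
def InvClosed (T : Set Γ.E) : Prop := ∀ e, e ∈ T ↔ Γ.inv e ∈ T

/-- `O` is (the set of positively oriented edges of) an orientation of `Γ∖T`. -/
def IsOrientation (T O : Set Γ.E) : Prop :=
  (∀ e ∈ O, e ∉ T) ∧ ∀ e, e ∉ T → (e ∈ O ↔ Γ.inv e ∉ O)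

/-- A totally cyclic orientation of `Γ∖T`: an orientation such that there is no
vertex set `W` which is nonempty and proper inside some connected component of
`Γ∖T` and such that all edges of `Γ∖T` crossing the boundary of `W` are oriented
out of `W` (this is the componentwise condition of the paper). -/
def IsTotallyCyclic (T O : Set Γ.E) : Prop :=
  Γ.IsOrientation T O ∧
    ¬ ∃ W : Set Γ.V, (∃ v ∈ W, ∃ w ∈ Wᶜ, Γ.Reach Tᶜ v w) ∧
        ∀ e ∈ O, Γ.t e ∈ W → Γ.s e ∈ W

/-- `γ` is (the set of positively oriented edges of) an oriented circuit of `Γ`: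
a cyclic subgraph (connected, first Betti number one, no separating edges)
together with a totally cyclic orientation; equivalently a directed cycle:
each incident vertex has exactly one outgoing and one incoming edge in `γ`,
and the support is connected. -/
def IsCircuit (γ : Finset Γ.E) : Prop :=
  γ.Nonempty ∧ (∀ e ∈ γ, Γ.inv e ∉ γ) ∧
    (∀ v ∈ γ.image Γ.s ∪ γ.image Γ.t, ∃! e, e ∈ γ ∧ Γ.s e = v) ∧
    (∀ v ∈ γ.image Γ.s ∪ γ.image Γ.t, ∃! e, e ∈ γ ∧ Γ.t e = v) ∧
    ∀ e ∈ γ, ∀ f ∈ γ, Γ.Reach ((↑γ : Set Γ.E) ∪ Γ.inv '' ↑γ) (Γ.s e) (Γ.s f)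

/-- The class `[γ] ∈ H₁(Γ,ℤ)` of an oriented circuit. -/
def circChainZ (γ : Finset Γ.E) : Γ.E → ℤ :=
  fun e => if e ∈ γ then 1 else if Γ.inv e ∈ γ then -1 else 0

/-- The class `[γ] ∈ H₁(Γ,ℝ)` of an oriented circuit. -/
noncomputable def circChainR (γ : Finset Γ.E) : Γ.E → ℝ :=
  fun e => (Γ.circChainZ γ e : ℝ)

/-- `Cir_φ(Γ∖T)`: oriented circuits of `Γ∖T` compatibly oriented with the
orientation with positive edges `O`. -/
def Cir (T O : Set Γ.E) : Set (Finset Γ.E) :=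
  {γ | Γ.IsCircuit γ ∧ (∀ e ∈ γ, e ∈ O) ∧ ∀ e ∈ γ, e ∉ T}

/-- `c` is a 1-cycle: a skew 1-chain with vanishing boundary, i.e. an element of
`H₁(Γ,A)`. -/
def IsCycle {A : Type*} [AddCommGroup A] (c : Γ.E → A) : Prop :=
  (∀ e, c (Γ.inv e) = - c e) ∧
    ∀ v, ∑ e ∈ Finset.univ.filter (fun e => Γ.t e = v), c e = 0

/-- An element of `H₁(Γ∖T, A) ⊆ H₁(Γ,A)`: a cycle supported on edges not in `T`. -/
def IsCycleOn {A : Type*} [AddCommGroup A] (T : Set Γ.E) (c : Γ.E → A) : Prop :=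
  Γ.IsCycle c ∧ ∀ e ∈ T, c e = 0

/-- The standard positive definite bilinear form on `C⃗₁(Γ,ℝ)`, for which
`(c, e⃗) = c e`. -/
noncomputable def pair (c c' : Γ.E → ℝ) : ℝ := (∑ e, c e * c' e) / 2

/-- The first Betti number `b₁(Γ) = dim_ℝ H₁(Γ,ℝ)`. -/
noncomputable def b1 : ℕ :=
  Module.finrank ℝ (Submodule.span ℝ {c : Γ.E → ℝ | Γ.IsCycle c})

/-- `b₁(Γ∖T) = dim_ℝ H₁(Γ∖T,ℝ)`. -/
noncomputable def b1Sub (T : Set Γ.E) : ℕ :=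
  Module.finrank ℝ (Submodule.span ℝ {c : Γ.E → ℝ | Γ.IsCycleOn T c})

/-- The cone `σ(T,φ) ⊆ H₁(Γ,ℝ)` of the cographic fan associated to a pair
`(T, O)` with `O` an orientation of `Γ∖T`. -/
def sigmaCone (T O : Set Γ.E) : Set (Γ.E → ℝ) :=
  {v | Γ.IsCycle v ∧ (∀ e ∈ O, 0 ≤ v e) ∧ ∀ e ∈ T, v e = 0}

/-- The poset `OP_Γ` of totally cyclic orientations: pairs `(T, O)` with `T` a
set of unoriented edges and `O` a totally cyclic orientation of `Γ∖T`. -/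
def OP : Set (Set Γ.E × Set Γ.E) :=
  {p | Γ.InvClosed p.1 ∧ Γ.IsTotallyCyclic p.1 p.2}

/-- The order on `OP_Γ`: `(T',φ') ≤ (T,φ)` iff `T' ⊇ T` and `φ'` is the
restriction of `φ`. -/
def OPle (p q : Set Γ.E × Set Γ.E) : Prop :=
  q.1 ⊆ p.1 ∧ p.2 = q.2 ∩ p.1ᶜ

/-- `H₁(Γ,ℤ)` viewed as the set of lattice points of `H₁(Γ,ℝ)`. -/
def H1Z : Set (Γ.E → ℝ) := {c | Γ.IsCycle c ∧ ∀ e, ∃ n : ℤ, c e = (n : ℝ)}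

/-- The Voronoi polytope `Vor_Γ ⊆ H₁(Γ,ℝ)`. -/
def voronoi : Set (Γ.E → ℝ) :=
  {v | Γ.IsCycle v ∧ ∀ l ∈ Γ.H1Z, Γ.pair v v ≤ Γ.pair (v - l) (v - l)}

/-- A (exposed) face of the Voronoi polytope. -/
def IsVorFace (F : Set (Γ.E → ℝ)) : Prop :=
  ∃ l : (Γ.E → ℝ) →ₗ[ℝ] ℝ, F = {v | v ∈ Γ.voronoi ∧ ∀ w ∈ Γ.voronoi, l w ≤ l v}

/-- The face `F(T,φ)` of the Voronoi polytope associated to `(T,O) ∈ OP_Γ`. -/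
def vorFace (T O : Set Γ.E) : Set (Γ.E → ℝ) :=
  {v | v ∈ Γ.voronoi ∧ ∀ γ ∈ Γ.Cir T O,
      Γ.pair v (Γ.circChainR γ) = Γ.pair (Γ.circChainR γ) (Γ.circChainR γ) / 2}

end SerreGraph


namespace SerreGraph

variable {Γ : SerreGraph}

theorem t_inv (e : Γ.E) : Γ.t (Γ.inv e) = Γ.s e := by
  rw [← Γ.s_inv, Γ.inv_inv]

theorem IsCycle.add {A : Type*} [AddCommGroup A] {c c' : Γ.E → A} (hc : Γ.IsCycle c)
    (hc' : Γ.IsCycle c') : Γ.IsCycle (c + c') := by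
  refine ⟨fun e => ?_, fun v => ?_⟩
  · rw [Pi.add_apply, Pi.add_apply, hc.1, hc'.1, neg_add]
  · simp only [Pi.add_apply, Finset.sum_add_distrib, hc.2, hc'.2, add_zero]

theorem IsCycle.map {A B : Type*} [AddCommGroup A] [AddCommGroup B] (f : A →+ B) {c : Γ.E → A}
    (hc : Γ.IsCycle c) : Γ.IsCycle (fun e => f (c e)) := by
  refine ⟨fun e => ?_, fun v => ?_⟩
  · simp only [hc.1, map_neg]
  · rw [← map_sum, hc.2, map_zero]

open scoped Classical in
/-- The net flow of a cycle into a vertex set vanishes. -/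
theorem IsCycle.sum_boundary {A : Type*} [AddCommGroup A] {c : Γ.E → A} (hc : Γ.IsCycle c)
    (W : Set Γ.V) :
    ∑ e ∈ Finset.univ.filter (fun e => Γ.t e ∈ W ∧ Γ.s e ∉ W), c e = 0 := by
  have total : ∑ e ∈ Finset.univ.filter (fun e => Γ.t e ∈ W), c e = 0 := by
    rw [← Finset.sum_fiberwise_of_maps_to
      (s := Finset.univ.filter (fun e => Γ.t e ∈ W)) (t := Finset.univ.filter (· ∈ W))
      (g := Γ.t) (by simp)]
    refine Finset.sum_eq_zero fun v hv => ?_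
    rw [← hc.2 v, Finset.filter_filter]
    refine Finset.sum_congr (Finset.filter_congr fun e _ => ?_) fun _ _ => rfl
    have hvW : v ∈ W := by simpa using hv
    exact ⟨And.right, fun h => ⟨h ▸ hvW, h⟩⟩
  have inner : ∑ e ∈ Finset.univ.filter (fun e => Γ.t e ∈ W ∧ Γ.s e ∈ W), c e = 0 := by
    refine Finset.sum_involution (fun e _ => Γ.inv e) (fun e _ => ?_) (fun e _ _ => Γ.inv_ne e)
      (fun e he => ?_) (fun e _ => Γ.inv_inv e)
    · rw [hc.1, add_neg_cancel]
    · simpa [t_inv, Γ.s_inv, and_comm] using he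
  rw [← Finset.sum_filter_add_sum_filter_not _ (fun e => Γ.s e ∈ W), Finset.filter_filter,
    Finset.filter_filter, inner, zero_add] at total
  exact total

/-- The signs of a cycle give a totally cyclic orientation of its support. -/
theorem IsCycle.isTotallyCyclic {A : Type*} [AddCommGroup A] [LinearOrder A]
    [IsOrderedAddMonoid A] {d : Γ.E → A} (hd : Γ.IsCycle d) :
    Γ.IsTotallyCyclic {e | d e = 0} {e | 0 < d e} := by
  refine ⟨⟨fun e he => ne_of_gt he, fun e he => ?_⟩, ?_⟩
  · simp only [Set.mem_ofPred_eq, hd.1, Left.neg_pos_iff, not_lt] at he ⊢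
    exact ⟨le_of_lt, fun h => lt_of_le_of_ne h (Ne.symm he)⟩
  · rintro ⟨W, ⟨v, hv, w, hw, hvw⟩, hW⟩
    have entering : ∀ e, Γ.t e ∈ W → Γ.s e ∉ W → d e = 0 := by
      classical
      intro e ht hs
      refine (Finset.sum_eq_zero_iff_of_nonpos fun f hf => ?_).1 (hd.sum_boundary W) e
        (by simp [ht, hs])
      simp only [Finset.mem_filter, Finset.mem_univ, true_and] at hf
      exact not_lt.1 fun h => hf.2 (hW f h hf.1)
    refine hw ?_
    clear hw
    induction hvw with
    | refl => exact hv
    | tail _ hab ih =>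
      obtain ⟨e, he, rfl, rfl⟩ := hab
      by_contra ht
      refine he ?_
      have := entering (Γ.inv e) (by rwa [t_inv]) (by rwa [Γ.s_inv])
      rwa [hd.1, neg_eq_zero] at this

end SerreGraph

/-- Two integral cycles `c, c'` lie in a common cone `σ(T,φ)`,
`(T,φ) ∈ OP_Γ`, iff `(c,e⃗)·(c',e⃗) ≥ 0` for every oriented edge `e⃗`. -/
theorem stmt10 (Γ : SerreGraph) (c c' : Γ.E → ℤ)
    (hc : Γ.IsCycle c) (hc' : Γ.IsCycle c') :
    (∃ p ∈ Γ.OP, (fun e => (c e : ℝ)) ∈ Γ.sigmaCone p.1 p.2 ∧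
        (fun e => (c' e : ℝ)) ∈ Γ.sigmaCone p.1 p.2) ↔
      ∀ e, 0 ≤ c e * c' e := by
  constructor
  · rintro ⟨⟨T, O⟩, ⟨-, hO, -⟩, ⟨-, hcO, hcT⟩, ⟨-, hcO', -⟩⟩ e
    have nonneg : ∀ f ∈ O, 0 ≤ c f * c' f := fun f hf =>
      mul_nonneg (Int.cast_nonneg_iff.1 (hcO f hf)) (Int.cast_nonneg_iff.1 (hcO' f hf))
    by_cases hT : e ∈ T
    · rw [Int.cast_eq_zero.1 (hcT e hT), zero_mul]
    by_cases he : e ∈ O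
    · exact nonneg e he
    · have hinv : Γ.inv e ∈ O := by
        by_contra h
        exact he ((hO.2 e hT).2 h)
      simpa only [hc.1, hc'.1, neg_mul_neg] using nonneg _ hinv
  · intro h
    have hd := hc.add hc'
    refine ⟨({e | (c + c') e = 0}, {e | 0 < (c + c') e}), ⟨fun e => ?_, hd.isTotallyCyclic⟩,
      ⟨hc.map (Int.castAddHom ℝ), fun e he => ?_, fun e he => ?_⟩,
      ⟨hc'.map (Int.castAddHom ℝ), fun e he => ?_, fun e he => ?_⟩⟩
    · simp only [Set.mem_ofPred_eq, hd.1, neg_eq_zero]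
    all_goals
      have hce := h e
      simp only [Set.mem_ofPred_eq, Pi.add_apply] at he
    · exact Int.cast_nonneg (by by_contra! hneg; nlinarith)
    · exact Int.cast_eq_zero.2 (by nlinarith)
    · exact Int.cast_nonneg (by by_contra! hneg; nlinarith)
    · exact Int.cast_eq_zero.2 (by nlinarith)
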